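/- Let a : ℤ^s → ℝ be a finitely supported interpolatory mask with dilation mI, |m| ≥ 2, i.e., a_0 = 1 and a_{mα} = 0 for all α ∈ ℤ^s ∖ {0}, and let k ∈ ℕ_0. If the symbol satisfies a(1,…,1) = |m|^s and (D^j a)(ε) = 0 for every ε ∈ Ξ′ and every multi-index j with |j| ≤ k, then (D^j a)(1,…,1) = 0 for every multi-index j with 1 ≤ |j| ≤ k; equivalently, (D^j a)(1,…,1) = |m|^s q_j(0) for every |j| ≤ k. -/

import Mathlib

open Finset Filter

noncomputable section

/-- Sequences indexed by `ℤ^s`. -/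
abbrev ZS (s : ℕ) := Fin s → ℤ

/-- `z^α = z_1^{α_1} ⋯ z_s^{α_s}` for `z ∈ ℂ^s`, `α ∈ ℤ^s`. -/
def zpowV {s : ℕ} (z : Fin s → ℂ) (α : Fin s → ℤ) : ℂ := ∏ i, z i ^ α i

/-- The tensor-product falling factorial polynomial
`q_j(x) = ∏_i ∏_{ℓ=0}^{j_i-1} (x_i - ℓ)` (complex version). -/
def qpolyC {s : ℕ} (j : Fin s → ℕ) (x : Fin s → ℂ) : ℂ :=
  ∏ i, ∏ l ∈ Finset.range (j i), (x i - l)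

/-- The tensor-product falling factorial polynomial (real version). -/
def qpolyR {s : ℕ} (j : Fin s → ℕ) (x : Fin s → ℝ) : ℝ :=
  ∏ i, ∏ l ∈ Finset.range (j i), (x i - l)

/-- `(D^j a)(z) = ∑_α q_j(α) a_α z^{α-j}`, the `j`-th iterated partial derivative of the symbol
`a(z) = ∑_α a_α z^α`.  For `j = 0` this is the symbol itself. -/
def symbolD {s : ℕ} (a : ZS s → ℝ) (j : Fin s → ℕ) (z : Fin s → ℂ) : ℂ :=
  ∑ᶠ α : ZS s, qpolyC j (fun i => (α i : ℂ)) * (a α : ℂ) * zpowV z (fun i => α i - (j i : ℤ))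

/-- The point `(1,…,1) ∈ ℂ^s`. -/
def onesC {s : ℕ} : Fin s → ℂ := fun _ => 1

/-- `e ∈ E = {0,…,|m|-1}^s`. -/
def inE {s : ℕ} (m : ℤ) (e : ZS s) : Prop := ∀ i, 0 ≤ e i ∧ e i < |m|

/-- `ε_e = (e^{-2πi e_1/m}, …, e^{-2πi e_s/m}) ∈ ℂ^s`. -/
def epsPt {s : ℕ} (m : ℤ) (e : ZS s) : Fin s → ℂ :=
  fun i => Complex.exp (-(2 * Real.pi * Complex.I * e i) / m)

/-- The subdivision operator `(S_a d)_α = ∑_β a_{α-mβ} d_β`. -/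
def subdOp {s : ℕ} (m : ℤ) (a : ZS s → ℝ) (d : ZS s → ℝ) : ZS s → ℝ :=
  fun α => ∑ᶠ β : ZS s, a (α - m • β) * d β

/-- The parameter values `t^{(r)}_α = α/m^r - τ ∑_{i=1}^r m^{-i}` attached to the data at
level `r`. -/
def param {s : ℕ} (m : ℤ) (τ : Fin s → ℝ) (r : ℕ) (α : ZS s) : Fin s → ℝ :=
  fun i => (α i : ℝ) / (m : ℝ) ^ r - τ i * ∑ n ∈ Finset.range r, ((m : ℝ) ^ (n + 1))⁻¹

/-- The subdivision scheme `S_a` (with dilation `mI` and parametrization offset `τ`) converges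
from initial data `d` to the limit `g`: there are continuous functions `F^{(r)}` interpolating
the data `S_a^r d` at the parameter values `t^{(r)}`, converging uniformly to `g`. -/
def ConvergesTo {s : ℕ} (m : ℤ) (a : ZS s → ℝ) (τ : Fin s → ℝ)
    (d : ZS s → ℝ) (g : (Fin s → ℝ) → ℝ) : Prop :=
  ∃ F : ℕ → (Fin s → ℝ) → ℝ,
    (∀ r, Continuous (F r)) ∧
    (∀ r α, F r (param m τ r α) = (subdOp m a)^[r] d α) ∧
    TendstoUniformly F g atTop

/-- Bounded data. -/
def Bdd {s : ℕ} (d : ZS s → ℝ) : Prop := ∃ C, ∀ α, |d α| ≤ C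

/-- The subdivision scheme is convergent: every bounded initial data admits a limit. -/
def Convergent {s : ℕ} (m : ℤ) (a : ZS s → ℝ) (τ : Fin s → ℝ) : Prop :=
  ∀ d, Bdd d → ∃ g, ConvergesTo m a τ d g

/-- The subdivision scheme is non-singular: it is convergent and a zero limit forces zero data. -/
def NonSingular {s : ℕ} (m : ℤ) (a : ZS s → ℝ) (τ : Fin s → ℝ) : Prop :=
  Convergent m a τ ∧
  ∀ d, Bdd d → ∀ g, ConvergesTo m a τ d g → g = 0 → (∀ α, d α = 0)

/-- `S_a` reproduces polynomials up to degree `k`: for every `s`-variate real polynomial `π` of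
total degree at most `k`, the scheme converges from the data `(π(α))_α` to the limit `π`. -/
def Reproduces {s : ℕ} (m : ℤ) (a : ZS s → ℝ) (τ : Fin s → ℝ) (k : ℕ) : Prop :=
  ∀ π : MvPolynomial (Fin s) ℝ, π.totalDegree ≤ k →
    ConvergesTo m a τ (fun α => MvPolynomial.eval (fun i => (α i : ℝ)) π)
      (fun x => MvPolynomial.eval x π)

/-- `S_a` is step-wise polynomial reproducing up to degree `k`:
`S_a (π(t^{(r)}_·)) = π(t^{(r+1)}_·)` for every polynomial `π` of total degree at most `k`. -/
def StepwiseReproduces {s : ℕ} (m : ℤ) (a : ZS s → ℝ) (τ : Fin s → ℝ) (k : ℕ) : Prop :=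
  ∀ π : MvPolynomial (Fin s) ℝ, π.totalDegree ≤ k → ∀ r : ℕ, ∀ α : ZS s,
    subdOp m a (fun β => MvPolynomial.eval (param m τ r β) π) α
      = MvPolynomial.eval (param m τ (r + 1) α) π

/-- Condition `Z_k`: `a(1,…,1) = |m|^s` and `(D^j a)(ε) = 0` for all `ε ∈ Ξ'` and `|j| < k`. -/
def CondZ {s : ℕ} (m : ℤ) (a : ZS s → ℝ) (k : ℕ) : Prop :=
  symbolD a 0 onesC = ((|m| : ℤ) : ℂ) ^ s ∧
  ∀ e : ZS s, inE m e → e ≠ 0 → ∀ j : Fin s → ℕ, (∑ i, j i) < k →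
    symbolD a j (epsPt m e) = 0

/-- The exponential sum over the residues modulo `m` detects divisibility by `m`. -/
theorem sum_exp_zpow_eq_ite (m : ℤ) (hm : m ≠ 0) (b : ℤ) :
    ∑ n ∈ Finset.Ico (0 : ℤ) |m|,
        Complex.exp (-(2 * Real.pi * Complex.I * (n : ℂ)) / m) ^ b
      = if m ∣ b then ((|m| : ℤ) : ℂ) else 0 := by
  have habs : |m| = (m.natAbs : ℤ) := Int.abs_eq_natAbs m
  have hmC : (m : ℂ) ≠ 0 := by exact_mod_cast hm
  have h2pi : (2 * Real.pi * Complex.I : ℂ) ≠ 0 := Complex.two_pi_I_ne_zero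
  set ζ : ℂ := Complex.exp (-(2 * Real.pi * Complex.I * (b : ℂ)) / m) with hζ
  have hsum : ∑ n ∈ Finset.Ico (0 : ℤ) |m|,
      Complex.exp (-(2 * Real.pi * Complex.I * (n : ℂ)) / m) ^ b
        = ∑ n ∈ Finset.range m.natAbs, ζ ^ n := by
    refine Finset.sum_bij' (fun n _ => n.toNat) (fun n _ => (n : ℤ)) ?_ ?_ ?_ ?_ ?_
    · intro n hn
      simp only [Finset.mem_Ico, Finset.mem_range] at hn ⊢
      omega
    · intro n hn
      simp only [Finset.mem_Ico, Finset.mem_range] at hn ⊢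
      omega
    · intro n hn
      exact Int.toNat_of_nonneg (Finset.mem_Ico.1 hn).1
    · intro n _
      exact Int.toNat_natCast n
    · intro n hn
      have hn0 : ((n.toNat : ℤ)) = n := Int.toNat_of_nonneg (Finset.mem_Ico.1 hn).1
      rw [← zpow_natCast ζ, hn0, hζ, ← Complex.exp_int_mul, ← Complex.exp_int_mul]
      congr 1
      ring
  have hone : ζ = 1 ↔ m ∣ b := by
    rw [hζ, Complex.exp_eq_one_iff]
    constructor
    · rintro ⟨n, hn⟩
      refine ⟨-n, ?_⟩
      rw [div_eq_iff hmC] at hn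
      have h : (2 * Real.pi * Complex.I : ℂ) * (b : ℂ)
          = (2 * Real.pi * Complex.I) * (m * -n) := by
        linear_combination -hn
      exact_mod_cast mul_left_cancel₀ h2pi h
    · rintro ⟨c, rfl⟩
      refine ⟨-c, ?_⟩
      rw [div_eq_iff hmC]
      push_cast
      ring
  rw [hsum]
  split_ifs with h
  · rw [hone.2 h, habs, Int.cast_natCast]
    simp only [one_pow, Finset.sum_const, Finset.card_range, nsmul_eq_mul, mul_one]
  · have hne : ζ ≠ 1 := fun h' => h (hone.1 h')
    have hpow : ζ ^ m.natAbs = 1 := by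
      have hz : ζ ^ m = 1 := by
        rw [hζ, ← Complex.exp_int_mul, Complex.exp_eq_one_iff]
        refine ⟨-b, ?_⟩
        push_cast
        field_simp
      rcases Int.natAbs_eq m with h' | h'
      · rw [h', zpow_natCast] at hz
        exact hz
      · rw [h', zpow_neg, zpow_natCast, inv_eq_one] at hz
        exact hz
    rw [geom_sum_eq hne, hpow, sub_self, zero_div]

/-- Summing `ε ^ α` over all `ε ∈ Ξ` detects whether `α` lies in the sublattice `mℤ^s`. -/
theorem sum_zpowV_epsPt {s : ℕ} (m : ℤ) (hm : m ≠ 0) (α : ZS s) :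
    ∑ e ∈ Fintype.piFinset (fun _ : Fin s => Finset.Ico (0 : ℤ) |m|), zpowV (epsPt m e) α
      = if ∀ i, m ∣ α i then ((|m| : ℤ) : ℂ) ^ s else 0 := by
  have h := Finset.prod_univ_sum (fun _ : Fin s => Finset.Ico (0 : ℤ) |m|)
    (fun i n => Complex.exp (-(2 * Real.pi * Complex.I * (n : ℂ)) / m) ^ α i)
  simp only [zpowV, epsPt]
  rw [← h]
  simp only [sum_exp_zpow_eq_ite m hm]
  split_ifs with hd
  · simp [hd]
  · obtain ⟨i, hi⟩ := not_forall.1 hd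
    exact Finset.prod_eq_zero (Finset.mem_univ i) (if_neg hi)

/-- For a finitely supported mask, `z ^ j (D^j a)(z)` is a finite sum over the support. -/
theorem zpowV_mul_symbolD {s : ℕ} (a : ZS s → ℝ) (ha : (Function.support a).Finite)
    (j : Fin s → ℕ) (z : Fin s → ℂ) (hz : ∀ i, z i ≠ 0) :
    zpowV z (fun i => (j i : ℤ)) * symbolD a j z
      = ∑ α ∈ ha.toFinset, qpolyC j (fun i => (α i : ℂ)) * (a α : ℂ) * zpowV z α := by
  have hsub : (Function.support fun α : ZS s => qpolyC j (fun i => (α i : ℂ)) * (a α : ℂ) *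
      zpowV z (fun i => α i - (j i : ℤ))) ⊆ ha.toFinset := by
    intro α hα
    rw [Set.Finite.coe_toFinset]
    intro h0
    exact hα (by simp [h0])
  rw [symbolD, finsum_eq_sum_of_support_subset _ hsub, Finset.mul_sum]
  refine Finset.sum_congr rfl fun α _ => ?_
  have hmul : zpowV z (fun i => (j i : ℤ)) * zpowV z (fun i => α i - (j i : ℤ)) = zpowV z α := by
    simp only [zpowV, ← Finset.prod_mul_distrib]
    refine Finset.prod_congr rfl fun i _ => ?_
    rw [← zpow_add₀ (hz i), add_sub_cancel]
  rw [← hmul]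
  ring

/-- For an interpolatory mask, the sum of `ε ^ j (D^j a)(ε)` over `ε ∈ Ξ` is `|m|^s q_j(0)`. -/
theorem sum_zpowV_mul_symbolD {s : ℕ} (m : ℤ) (hm : m ≠ 0) (a : ZS s → ℝ)
    (ha : (Function.support a).Finite) (hint0 : a 0 = 1)
    (hint : ∀ α : ZS s, α ≠ 0 → a (m • α) = 0) (j : Fin s → ℕ) :
    ∑ e ∈ Fintype.piFinset (fun _ : Fin s => Finset.Ico (0 : ℤ) |m|),
        zpowV (epsPt m e) (fun i => (j i : ℤ)) * symbolD a j (epsPt m e)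
      = ((|m| : ℤ) : ℂ) ^ s * qpolyC j (fun _ => (0 : ℂ)) := by
  have hne : ∀ e : ZS s, ∀ i, epsPt m e i ≠ 0 := fun e i => Complex.exp_ne_zero _
  simp only [fun e => zpowV_mul_symbolD a ha j (epsPt m e) (hne e)]
  rw [Finset.sum_comm]
  simp only [← Finset.mul_sum, sum_zpowV_epsPt m hm]
  rw [Finset.sum_eq_single (0 : ZS s)]
  · simp [hint0, mul_comm]
  · intro α _ hα
    split_ifs with hd
    · choose β hβ using hd
      have hαβ : α = m • β := by
        ext i
        simp [hβ i]
      have hβ0 : β ≠ 0 := by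
        rintro rfl
        exact hα (by simp [hαβ])
      rw [hαβ, hint β hβ0]
      simp
    · simp
  · intro h
    simp [hint0] at h

/-- The polynomial `q_j` vanishes at the origin for `j ≠ 0`. -/
theorem qpolyC_zero_of_one_le {s : ℕ} (j : Fin s → ℕ) (hj : 1 ≤ ∑ i, j i) :
    qpolyC j (fun _ => (0 : ℂ)) = 0 := by
  obtain ⟨i, -, hi⟩ := Finset.exists_ne_zero_of_sum_ne_zero (Nat.one_le_iff_ne_zero.1 hj)
  refine Finset.prod_eq_zero (Finset.mem_univ i) ?_
  exact Finset.prod_eq_zero (Finset.mem_range.2 (Nat.pos_of_ne_zero hi)) (by simp)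

/-- For an interpolatory mask (`a_0 = 1`, `a_{mα} = 0` for `α ≠ 0`) whose
symbol satisfies `a(1,…,1) = |m|^s` and `(D^j a)(ε) = 0` for all `ε ∈ Ξ'`, `|j| ≤ k`, one has
`(D^j a)(1,…,1) = 0` for `1 ≤ |j| ≤ k`; equivalently `(D^j a)(1,…,1) = |m|^s q_j(0)` for all
`|j| ≤ k`. -/
theorem stmt15 {s : ℕ} (hs : 1 ≤ s) (m : ℤ) (hm : 2 ≤ |m|)
    (a : ZS s → ℝ) (ha : (Function.support a).Finite)
    (hint0 : a 0 = 1) (hint : ∀ α : ZS s, α ≠ 0 → a (m • α) = 0) (k : ℕ)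
    (h1 : symbolD a 0 onesC = ((|m| : ℤ) : ℂ) ^ s)
    (hz : ∀ j : Fin s → ℕ, (∑ i, j i) ≤ k →
      ∀ e : ZS s, inE m e → e ≠ 0 → symbolD a j (epsPt m e) = 0) :
    (∀ j : Fin s → ℕ, 1 ≤ (∑ i, j i) → (∑ i, j i) ≤ k → symbolD a j onesC = 0) ∧
    (∀ j : Fin s → ℕ, (∑ i, j i) ≤ k →
      symbolD a j onesC = ((|m| : ℤ) : ℂ) ^ s * qpolyC j (fun _ => (0 : ℂ))) := by
  have hm0 : m ≠ 0 := by
    rintro rfl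
    simp at hm
  have key : ∀ j : Fin s → ℕ, (∑ i, j i) ≤ k →
      symbolD a j onesC = ((|m| : ℤ) : ℂ) ^ s * qpolyC j (fun _ => (0 : ℂ)) := by
    intro j hj
    rw [← sum_zpowV_mul_symbolD m hm0 a ha hint0 hint j, Finset.sum_eq_single (0 : ZS s)]
    · have h0 : epsPt m (0 : ZS s) = onesC := by
        ext i
        simp [epsPt, onesC]
      rw [h0]
      simp [zpowV, onesC]
    · intro e he hne
      have hE : inE m e := fun i => Finset.mem_Ico.1 (Fintype.mem_piFinset.1 he i)
      rw [hz j hj e hE hne, mul_zero]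
    · intro h
      refine absurd (Fintype.mem_piFinset.2 fun i => ?_) h
      simpa using hm0
  refine ⟨fun j hj1 hj => ?_, key⟩
  rw [key j hj, qpolyC_zero_of_one_le j hj1, mul_zero]
end
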